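/- Let t ∈ {3, 5, 7}, let k and n be positive integers, let p be a prime number with p ≡ t (mod 8), and let r be a nonnegative integer such that p divides 8r + t. Then B_{3,2}( p^{k+1} n + p r + (tp − 1)/8 ) ≡ −(−2/p)_L · B_{3,2}( p^{k−1} n + (8r + t − p)/(8p) ) (mod 3). -/

import Mathlib

/-- The number of `t`-regular partitions of `n`, i.e. partitions of `n`
none of whose parts is divisible by `t`. -/
noncomputable def regularPartitionCount (t n : ℕ) : ℕ :=
  Nat.card {π : n.Partition // ∀ x ∈ π.parts, ¬ t ∣ x}

/-- `B u v n` is the number of `(u,v)`-regular bipartitions of `n`: pairs `(α, β)` of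
partitions with `|α| + |β| = n`, `α` being `u`-regular and `β` being `v`-regular. -/
noncomputable def B (u v n : ℕ) : ℕ :=
  ∑ i ∈ Finset.range (n + 1), regularPartitionCount u i * regularPartitionCount v (n - i)

open Finset PowerSeries

/-- The generalized triangular number `m * (m + 1) / 2`, for an integer `m`. -/
def triangular (m : ℤ) : ℕ := (m * (m + 1) / 2).toNat

lemma two_mul_triangular (m : ℤ) : 2 * (triangular m : ℤ) = m * (m + 1) := by
  have h : 0 ≤ m * (m + 1) := by
    rcases le_or_gt 0 m with h | h <;> nlinarith
  have h2 : (2 : ℤ) ∣ m * (m + 1) := (Int.even_mul_succ_self m).two_dvd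
  rw [triangular, Int.toNat_of_nonneg (by omega)]
  omega

/-- The exponent of the `m`-th term of the theta series attached to `(a, c)`. -/
def thetaExp (a c : ℕ) (m : ℤ) : ℕ := a * triangular m + c * triangular (-m)

lemma two_mul_thetaExp (a c : ℕ) (m : ℤ) :
    2 * (thetaExp a c m : ℤ) = a * (m * (m + 1)) + c * (m * (m - 1)) := by
  have h1 := two_mul_triangular m
  have h2 := two_mul_triangular (-m)
  rw [thetaExp]
  push_cast
  linear_combination (a : ℤ) * h1 + (c : ℤ) * h2

lemma natAbs_le_thetaExp {a c : ℕ} (ha : 0 < a) (hc : 0 < c) (m : ℤ) :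
    m.natAbs ≤ thetaExp a c m := by
  have h1 := two_mul_triangular m
  have h2 := two_mul_triangular (-m)
  have h : triangular m + triangular (-m) ≤ thetaExp a c m :=
    Nat.add_le_add (Nat.le_mul_of_pos_left _ ha) (Nat.le_mul_of_pos_left _ hc)
  have h3 : (m.natAbs : ℤ) ≤ m ^ 2 := by
    rw [← Int.natAbs_sq]
    exact_mod_cast Nat.le_self_pow two_ne_zero _
  zify at h ⊢
  push_cast at h3
  nlinarith

section GaussBinom

variable {A : Type*} [CommRing A]

/-- The Gaussian binomial coefficient with parameter `q`. -/
def gaussBinom (q : A) : ℕ → ℕ → A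
  | _, 0 => 1
  | 0, _ + 1 => 0
  | n + 1, k + 1 => gaussBinom q n k + q ^ (k + 1) * gaussBinom q n (k + 1)

/-- The finite product `(1 - q) (1 - q ^ 2) ⋯ (1 - q ^ n)`. -/
def qFactorial (q : A) (n : ℕ) : A := ∏ i ∈ range n, (1 - q ^ (i + 1))

lemma qFactorial_succ (q : A) (n : ℕ) :
    qFactorial q (n + 1) = qFactorial q n * (1 - q ^ (n + 1)) := prod_range_succ _ _

@[simp]
lemma gaussBinom_zero_right (q : A) (n : ℕ) : gaussBinom q n 0 = 1 := by
  cases n <;> rfl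

lemma gaussBinom_succ_succ (q : A) (n k : ℕ) :
    gaussBinom q (n + 1) (k + 1) = gaussBinom q n k + q ^ (k + 1) * gaussBinom q n (k + 1) := rfl

lemma gaussBinom_of_lt (q : A) {n k : ℕ} (h : n < k) : gaussBinom q n k = 0 := by
  induction n generalizing k with
  | zero => obtain ⟨k, rfl⟩ := Nat.exists_eq_add_one_of_ne_zero h.ne'; rfl
  | succ n ih =>
    obtain ⟨k, rfl⟩ := Nat.exists_eq_add_one_of_ne_zero (Nat.ne_zero_of_lt h)
    rw [gaussBinom_succ_succ, ih (by omega), ih (by omega)]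
    simp

lemma gaussBinom_mul_qFactorial (q : A) (i j : ℕ) :
    gaussBinom q (i + j) i * qFactorial q i * qFactorial q j = qFactorial q (i + j) := by
  induction i generalizing j with
  | zero => simp [qFactorial]
  | succ i ihi =>
    induction j with
    | zero =>
      have := ihi 0
      simp only [add_zero] at this ⊢
      rw [gaussBinom_succ_succ, gaussBinom_of_lt q (Nat.lt_succ_self i), qFactorial_succ]
      linear_combination (1 - q ^ (i + 1)) * this
    | succ j ihj =>
      have h1 := ihi (j + 1)
      rw [show i + 1 + (j + 1) = (i + (j + 1)) + 1 by ring, gaussBinom_succ_succ]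
      rw [show i + 1 + j = i + (j + 1) by ring] at ihj
      rw [qFactorial_succ q (i + (j + 1)), qFactorial_succ q i, qFactorial_succ q j]
      rw [qFactorial_succ q j] at h1
      rw [qFactorial_succ q i] at ihj
      rw [show i + (j + 1) + 1 = (i + 1) + (j + 1) by ring, pow_add q (i + 1) (j + 1)]
      linear_combination (1 - q ^ (i + 1)) * h1 + q ^ (i + 1) * (1 - q ^ (j + 1)) * ihj

/-- The `q`-binomial theorem. -/
lemma prod_add_mul_pow_eq_sum_gaussBinom (q y z : A) (n : ℕ) :
    ∏ i ∈ range n, (y + z * q ^ i) =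
      ∑ k ∈ range (n + 1), q ^ k.choose 2 * gaussBinom q n k * z ^ k * y ^ (n - k) := by
  induction n generalizing z with
  | zero => simp
  | succ n ih =>
    have h : ∀ i, y + z * q ^ (i + 1) = y + z * q * q ^ i := fun i ↦ by ring
    rw [prod_range_succ', pow_zero, mul_one]
    simp_rw [h]
    rw [ih, mul_add, sum_range_succ' _ (n + 1)]
    have h1 : ∀ k ∈ range (n + 1), q ^ (k + 1).choose 2 * gaussBinom q (n + 1) (k + 1) *
        z ^ (k + 1) * y ^ (n + 1 - (k + 1)) =
        q ^ k.choose 2 * gaussBinom q n k * (z * q) ^ k * y ^ (n - k) * z +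
        q ^ (k + 1).choose 2 * gaussBinom q n (k + 1) * (z * q) ^ (k + 1) * y ^ (n - k) := by
      intro k _
      rw [gaussBinom_succ_succ, Nat.add_sub_add_right, Nat.choose_succ_succ' k 1]
      simp only [Nat.choose_one_right]
      ring
    rw [sum_congr rfl h1, sum_add_distrib, ← sum_mul, add_comm, add_assoc]
    congr 1
    rw [sum_range_succ' _ n, sum_range_succ _ n, gaussBinom_of_lt q (Nat.lt_succ_self n)]
    simp only [mul_zero, zero_mul, add_zero, add_mul, sum_mul]
    congr 1
    · refine sum_congr rfl fun k hk ↦ ?_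
      rw [mem_range] at hk
      rw [show n - k = n - (k + 1) + 1 by omega]
      ring
    · simp [pow_succ]

@[simp]
lemma map_qFactorial {B : Type*} [CommRing B] (f : A →+* B) (q : A) (n : ℕ) :
    f (qFactorial q n) = qFactorial (f q) n := by
  simp [qFactorial]

@[simp]
lemma map_gaussBinom {B : Type*} [CommRing B] (f : A →+* B) (q : A) (n k : ℕ) :
    f (gaussBinom q n k) = gaussBinom (f q) n k := by
  induction n generalizing k with
  | zero => cases k <;> simp [gaussBinom]
  | succ n ih => cases k <;> simp [gaussBinom_succ_succ, ih]

lemma qFactorial_eq_of_pow_eq_zero {q : A} {l : ℕ} (hq : q ^ (l + 1) = 0) {n : ℕ} (hn : l ≤ n) :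
    qFactorial q n = qFactorial q l := by
  induction n, hn using Nat.le_induction with
  | base => rfl
  | succ n hn ih =>
    rw [qFactorial_succ, ih, pow_eq_zero_of_le (by omega) hq]
    simp

lemma isUnit_qFactorial {q : A} (hq : IsNilpotent q) (n : ℕ) : IsUnit (qFactorial q n) := by
  induction n with
  | zero => simp [qFactorial]
  | succ n ih =>
    rw [qFactorial_succ]
    exact ih.mul (hq.pow_succ n).isUnit_one_sub

lemma gaussBinom_mul_qFactorial_eq_one {q : A} {l : ℕ} (hq : q ^ (l + 1) = 0) {i j k : ℕ}
    (hi : l ≤ i) (hj : l ≤ j) (hk : l ≤ k) : gaussBinom q (i + j) i * qFactorial q k = 1 := by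
  have h := gaussBinom_mul_qFactorial q i j
  rw [qFactorial_eq_of_pow_eq_zero hq hi, qFactorial_eq_of_pow_eq_zero hq hj,
    qFactorial_eq_of_pow_eq_zero hq (hi.trans (Nat.le_add_right i j))] at h
  rw [qFactorial_eq_of_pow_eq_zero hq hk]
  exact (isUnit_qFactorial ⟨l + 1, hq⟩ l).mul_right_cancel (by rw [h, one_mul])

lemma qFactorial_three_mul (x : A) (n : ℕ) : qFactorial x (3 * n) = qFactorial (x ^ 3) n *
    ∏ i ∈ range n, ((1 - x ^ (3 * i + 1)) * (1 - x ^ (3 * i + 2))) := by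
  induction n with
  | zero => simp [qFactorial]
  | succ n ih =>
    rw [show 3 * (n + 1) = 3 * n + 1 + 1 + 1 by ring, prod_range_succ]
    simp only [qFactorial_succ, ih]
    ring

lemma qFactorial_four_mul (x : A) (n : ℕ) : qFactorial x (4 * n) * qFactorial (x ^ 2) (2 * n) =
    (qFactorial (x ^ 4) n * ∏ i ∈ range n, ((1 - x ^ (4 * i + 1)) * (1 - x ^ (4 * i + 3)))) *
    (qFactorial (x ^ 4) n * ∏ i ∈ range n, ((1 - x ^ (4 * i + 2)) * (1 - x ^ (4 * i + 2)))) := by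
  induction n with
  | zero => simp [qFactorial]
  | succ n ih =>
    rw [show 4 * (n + 1) = 4 * n + 1 + 1 + 1 + 1 by ring, show 2 * (n + 1) = 2 * n + 1 + 1 by ring]
    simp only [qFactorial_succ, prod_range_succ]
    linear_combination (1 - x ^ (4 * n + 1)) * (1 - x ^ (4 * n + 2)) * (1 - x ^ (4 * n + 3)) *
      (1 - x ^ (4 * n + 4)) * (1 - x ^ (4 * n + 2)) * (1 - x ^ (4 * n + 4)) * ih

end GaussBinom

universe u

section Theta

variable {R : Type*} [CommRing R]

/-- The sum of the terms with index in `[-n, n]` of the theta series attached to `(a, c)`. -/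
noncomputable def thetaTrunc (R : Type*) [CommRing R] (a c n : ℕ) : R⟦X⟧ :=
  ∑ m ∈ Icc (-n : ℤ) n, (-1) ^ m.natAbs * X ^ thetaExp a c m

lemma sum_range_eq_sum_Icc {M : Type*} [AddCommMonoid M] (n : ℕ) (f : ℤ → M) :
    ∑ k ∈ range (2 * n + 1), f (k - n) = ∑ m ∈ Icc (-n : ℤ) n, f m := by
  refine sum_nbij' (fun k ↦ (k : ℤ) - n) (fun m ↦ (m + n).toNat) ?_ ?_ ?_ ?_ ?_
  all_goals simp only [mem_range, mem_Icc, implies_true]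
  all_goals omega

lemma X_pow_mul_left_cancel {k : ℕ} {f g : R⟦X⟧} (h : X ^ k * f = X ^ k * g) : f = g := by
  ext d
  have := congrArg (coeff (d + k)) h
  simpa [coeff_X_pow_mul] using this

/-- A finite form of the Jacobi triple product identity. -/
lemma prod_eq_sum_gaussBinom (a c n : ℕ) :
    ∏ i ∈ range n, ((1 - (X : R⟦X⟧) ^ ((a + c) * i + a)) * (1 - X ^ ((a + c) * i + c))) =
      ∑ m ∈ Icc (-n : ℤ) n, (-1) ^ m.natAbs * X ^ thetaExp a c m *
        gaussBinom (X ^ (a + c)) (2 * n) (m + n).toNat := by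
  have key := prod_add_mul_pow_eq_sum_gaussBinom ((X : R⟦X⟧) ^ (a + c))
    (X ^ ((a + c) * n)) (-X ^ a) (2 * n)
  have hE : ∏ i ∈ range n, (X : R⟦X⟧) ^ ((a + c) * i + a) =
      X ^ (∑ i ∈ range n, ((a + c) * i + a)) :=
    prod_pow_eq_pow_sum _ _ _
  set E := ∑ i ∈ range n, ((a + c) * i + a) with hEdef
  have hE2 : 2 * (E : ℤ) = (a + c) * (n * (n - 1)) + 2 * (a * n) := by
    rw [hEdef]
    clear * -
    induction n with
    | zero => simp
    | succ n ih =>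
      rw [sum_range_succ]
      push_cast at ih ⊢
      linear_combination ih
  have hL : ∏ i ∈ range (2 * n), ((X : R⟦X⟧) ^ ((a + c) * n) + -X ^ a * (X ^ (a + c)) ^ i) =
      X ^ (E + (a + c) * n * n) * ((-1) ^ n * ∏ i ∈ range n,
        ((1 - (X : R⟦X⟧) ^ ((a + c) * i + a)) * (1 - X ^ ((a + c) * i + c)))) := by
    rw [two_mul, prod_range_add]
    have h1 : ∏ i ∈ range n, ((X : R⟦X⟧) ^ ((a + c) * n) + -X ^ a * (X ^ (a + c)) ^ i) =
        (-1) ^ n * X ^ E * ∏ i ∈ range n, (1 - (X : R⟦X⟧) ^ ((a + c) * i + c)) := by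
      rw [← prod_range_reflect (fun i ↦ 1 - (X : R⟦X⟧) ^ ((a + c) * i + c)), ← hE,
        ← card_range n, ← prod_const, card_range, ← prod_mul_distrib, ← prod_mul_distrib]
      refine prod_congr rfl fun i hi ↦ ?_
      rw [mem_range] at hi
      obtain ⟨j, rfl⟩ := Nat.exists_eq_add_of_lt hi
      rw [show i + j + 1 - 1 - i = j by omega]
      ring
    have h2 : ∏ i ∈ range n, ((X : R⟦X⟧) ^ ((a + c) * n) + -X ^ a * (X ^ (a + c)) ^ (n + i)) =
        X ^ ((a + c) * n * n) * ∏ i ∈ range n, (1 - (X : R⟦X⟧) ^ ((a + c) * i + a)) := by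
      rw [pow_mul X ((a + c) * n) n, pow_eq_prod_const (X ^ ((a + c) * n)) n, ← prod_mul_distrib]
      refine prod_congr rfl fun i _ ↦ ?_
      ring
    rw [h1, h2, prod_mul_distrib]
    ring
  rw [hL] at key
  rw [← sum_range_eq_sum_Icc]
  have hu : ((-1 : R⟦X⟧) ^ n) * (-1) ^ n = 1 := by rw [← mul_pow]; simp
  have hR : ∑ k ∈ range (2 * n + 1), ((X : R⟦X⟧) ^ (a + c)) ^ k.choose 2 *
        gaussBinom (X ^ (a + c)) (2 * n) k * (-X ^ a) ^ k * (X ^ ((a + c) * n)) ^ (2 * n - k) =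
      X ^ (E + (a + c) * n * n) * ((-1) ^ n * ∑ k ∈ range (2 * n + 1),
        ((-1) ^ ((k : ℤ) - n).natAbs * X ^ thetaExp a c (k - n) *
        gaussBinom (X ^ (a + c)) (2 * n) ((k : ℤ) - n + n).toNat)) := by
    rw [mul_sum, mul_sum]
    refine sum_congr rfl fun k hk ↦ ?_
    have hk' : k ≤ 2 * n := by simpa [Nat.lt_succ_iff] using hk
    rw [show ((k : ℤ) - n + n).toNat = k by simp]
    have hs : (-1 : R⟦X⟧) ^ k = (-1) ^ n * (-1) ^ ((k : ℤ) - n).natAbs := by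
      rw [← pow_add]
      exact neg_one_pow_congr (by grind)
    have he : (a + c) * k.choose 2 + a * k + (a + c) * n * (2 * n - k) =
        E + (a + c) * n * n + thetaExp a c (k - n) := by
      have h1 := two_mul_thetaExp a c (k - n)
      have h2 : 2 * (k.choose 2 : ℤ) = k * (k - 1) := by
        rw [← Nat.cast_two, ← Nat.cast_mul, mul_comm, Nat.choose_two_right,
          Nat.div_mul_cancel (Nat.even_mul_pred_self k).two_dvd]
        cases k <;> simp
      zify [hk']
      linarith [congrArg (((a : ℤ) + c) * ·) h2]
    rw [neg_pow, hs]
    generalize hG : gaussBinom ((X : R⟦X⟧) ^ (a + c)) (2 * n) k = G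
    calc _ = (-1) ^ n * (-1) ^ ((k : ℤ) - n).natAbs * G *
          X ^ ((a + c) * k.choose 2 + a * k + (a + c) * n * (2 * n - k)) := by ring
      _ = _ := by rw [he]; ring
  rw [hR] at key
  have := congrArg (fun t ↦ (-1) ^ n * t) (X_pow_mul_left_cancel key)
  simp only [← mul_assoc, hu] at this
  simpa only [one_mul] using this


/-- The finite products on the product side of the Jacobi triple product identity. -/
noncomputable def thetaProd (R : Type*) [CommRing R] (a c n : ℕ) : R⟦X⟧ :=
  qFactorial (X ^ (a + c)) n *
    ∏ i ∈ range n, ((1 - X ^ ((a + c) * i + a)) * (1 - X ^ ((a + c) * i + c)))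

lemma exists_ringHom_X_pow (R : Type u) [CommRing R] (n : ℕ) :
    ∃ (A : Type u) (_ : CommRing A) (φ : R⟦X⟧ →+* A), φ X ^ n = 0 ∧
      ∀ f g, φ f = φ g ↔ X ^ n ∣ f - g := by
  refine ⟨_, inferInstance, Ideal.Quotient.mk (Ideal.span {X ^ n}), ?_, fun f g ↦ ?_⟩
  · rw [← map_pow]
    exact Ideal.Quotient.eq_zero_iff_mem.2 (Ideal.mem_span_singleton_self _)
  · rw [Ideal.Quotient.eq, Ideal.mem_span_singleton]

/-- The Jacobi triple product identity modulo `X ^ (n + 1)`. -/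
lemma X_pow_dvd_thetaProd_sub_thetaTrunc {a c : ℕ} (ha : 0 < a) (hc : 0 < c) (n : ℕ) :
    (X : R⟦X⟧) ^ (n + 1) ∣ thetaProd R a c n - thetaTrunc R a c n := by
  rw [thetaProd, thetaTrunc, prod_eq_sum_gaussBinom, mul_sum, ← sum_sub_distrib]
  refine dvd_sum fun m hm ↦ ?_
  rw [mem_Icc] at hm
  have h : (X : R⟦X⟧) ^ (n - m.natAbs + 1) ∣
      gaussBinom (X ^ (a + c)) (2 * n) (m + n).toNat * qFactorial (X ^ (a + c)) n - 1 := by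
    obtain ⟨A, _, φ, hX, hφ⟩ := exists_ringHom_X_pow R (n - m.natAbs + 1)
    rw [← hφ, map_mul, map_gaussBinom, map_qFactorial, map_one, map_pow]
    obtain ⟨j, hj⟩ : ∃ j, 2 * n = (m + n).toNat + j := ⟨2 * n - (m + n).toNat, by omega⟩
    rw [hj]
    refine gaussBinom_mul_qFactorial_eq_one (l := n - m.natAbs) ?_ (by omega) (by omega) (by omega)
    rw [pow_right_comm, hX, zero_pow (by omega)]
  have h2 := natAbs_le_thetaExp ha hc m
  calc (X : R⟦X⟧) ^ (n + 1) ∣ X ^ (thetaExp a c m) * X ^ (n - m.natAbs + 1) := by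
        rw [← pow_add]
        exact pow_dvd_pow _ (by omega)
    _ ∣ X ^ (thetaExp a c m) * (gaussBinom (X ^ (a + c)) (2 * n) (m + n).toNat *
          qFactorial (X ^ (a + c)) n - 1) := mul_dvd_mul_left _ h
    _ ∣ (-1) ^ m.natAbs * (X ^ (thetaExp a c m) * (gaussBinom (X ^ (a + c)) (2 * n)
          (m + n).toNat * qFactorial (X ^ (a + c)) n - 1)) := dvd_mul_left _ _
    _ = _ := by ring

lemma qFactorial_pow_eq {A : Type*} [CommRing A] {x : A} {n e k : ℕ} (hx : x ^ (n + 1) = 0)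
    (he : e ≠ 0) (hk : n ≤ k) : qFactorial (x ^ e) n = qFactorial (x ^ e) k :=
  (qFactorial_eq_of_pow_eq_zero (by rw [pow_right_comm, hx, zero_pow he]) hk).symm

lemma X_pow_dvd_eulerProd_sub_theta_one_three (n : ℕ) : (X : R⟦X⟧) ^ (n + 1) ∣
    qFactorial X n * qFactorial (X ^ 2) n - thetaTrunc R 1 3 n * thetaTrunc R 2 2 n := by
  obtain ⟨A, _, φ, hX, hφ⟩ := exists_ringHom_X_pow R (n + 1)
  have h1 := (hφ _ _).2 (X_pow_dvd_thetaProd_sub_thetaTrunc (R := R) one_pos three_pos n)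
  have h2 := (hφ _ _).2 (X_pow_dvd_thetaProd_sub_thetaTrunc (R := R) two_pos two_pos n)
  have h3 := qFactorial_pow_eq hX one_ne_zero (show n ≤ 4 * n by omega)
  have h4 := qFactorial_pow_eq hX two_ne_zero (show n ≤ 2 * n by omega)
  rw [pow_one] at h3
  rw [← hφ, map_mul, map_mul, ← h1, ← h2, map_qFactorial, map_qFactorial, map_pow, h3, h4,
    qFactorial_four_mul]
  simp [thetaProd]

lemma X_pow_dvd_eulerProd_sub_theta_one_two (n : ℕ) : (X : R⟦X⟧) ^ (n + 1) ∣
    qFactorial X n * qFactorial (X ^ 2) n - thetaTrunc R 1 2 n * thetaTrunc R 2 4 n := by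
  obtain ⟨A, _, φ, hX, hφ⟩ := exists_ringHom_X_pow R (n + 1)
  have h1 := (hφ _ _).2 (X_pow_dvd_thetaProd_sub_thetaTrunc (R := R) one_pos two_pos n)
  have h2 := (hφ _ _).2 (X_pow_dvd_thetaProd_sub_thetaTrunc (R := R) two_pos four_pos n)
  have h3 := qFactorial_pow_eq hX one_ne_zero (show n ≤ 3 * n by omega)
  have h4 := qFactorial_pow_eq hX two_ne_zero (show n ≤ 3 * n by omega)
  rw [pow_one] at h3
  rw [← hφ, map_mul, map_mul, ← h1, ← h2, map_qFactorial, map_qFactorial, map_pow, h3, h4,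
    qFactorial_three_mul, qFactorial_three_mul]
  have h5 : ∀ i, (φ X ^ 2) ^ (3 * i + 1) = φ X ^ (6 * i + 2) := fun i ↦ by ring
  have h6 : ∀ i, (φ X ^ 2) ^ (3 * i + 2) = φ X ^ (6 * i + 4) := fun i ↦ by ring
  simp [thetaProd, h5, h6, ← pow_mul]

lemma coeff_thetaTrunc_mul (a c a' c' n N : ℕ) :
    coeff N (thetaTrunc R a c n * thetaTrunc R a' c' n) =
      ∑ z ∈ (Icc (-n : ℤ) n ×ˢ Icc (-n : ℤ) n) with thetaExp a c z.1 + thetaExp a' c' z.2 = N,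
        (-1) ^ (z.1.natAbs + z.2.natAbs) := by
  rw [thetaTrunc, thetaTrunc, sum_mul_sum, ← sum_product', map_sum, sum_filter]
  refine sum_congr rfl fun z _ ↦ ?_
  rw [show (-1 : R⟦X⟧) ^ z.1.natAbs * X ^ thetaExp a c z.1 *
      ((-1) ^ z.2.natAbs * X ^ thetaExp a' c' z.2) =
      C ((-1) ^ (z.1.natAbs + z.2.natAbs)) * X ^ (thetaExp a c z.1 + thetaExp a' c' z.2) by
    simp; ring, coeff_C_mul, coeff_X_pow]
  simp [eq_comm]

/-- Reindexing the lattice points counted by a coefficient of a product of two theta series. -/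
lemma coeff_thetaTrunc_mul_eq {a c a' c' n N M : ℕ} (ha : 0 < a) (hc : 0 < c) (ha' : 0 < a')
    (hc' : 0 < c') (hN : N ≤ n) (hM : M ≤ n) {φ ψ : ℤ → ℤ} (hφ : φ.Injective) (hψ : ψ.Injective)
    (s : ℤ) (hs : ∀ x y, Even (φ x + ψ y) ↔ Even (s + (x + y)))
    (h1 : ∀ x y, thetaExp a c x + thetaExp a' c' y = M →
      thetaExp a c (φ x) + thetaExp a' c' (ψ y) = N)
    (h2 : ∀ x y, thetaExp a c x + thetaExp a' c' y = N →
      ∃ x' y', φ x' = x ∧ ψ y' = y ∧ thetaExp a c x' + thetaExp a' c' y' = M) :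
    coeff N (thetaTrunc R a c n * thetaTrunc R a' c' n) =
      (-1) ^ s.natAbs * coeff M (thetaTrunc R a c n * thetaTrunc R a' c' n) := by
  have hmem : ∀ K ≤ n, ∀ x y, thetaExp a c x + thetaExp a' c' y = K →
      (x, y) ∈ Icc (-n : ℤ) n ×ˢ Icc (-n : ℤ) n := by
    intro K hK x y hxy
    have := natAbs_le_thetaExp ha hc x
    have := natAbs_le_thetaExp ha' hc' y
    simp only [mem_product, mem_Icc]
    omega
  rw [coeff_thetaTrunc_mul, coeff_thetaTrunc_mul, mul_sum]
  symm
  refine sum_nbij (Prod.map φ ψ) ?_ ((hφ.prodMap hψ).injOn) ?_ ?_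
  · rintro ⟨x, y⟩ hxy
    rw [mem_filter] at hxy ⊢
    exact ⟨hmem N hN _ _ (h1 x y hxy.2), h1 x y hxy.2⟩
  · rintro ⟨x, y⟩ hxy
    rw [mem_coe, mem_filter] at hxy
    obtain ⟨x', y', rfl, rfl, h⟩ := h2 x y hxy.2
    exact ⟨(x', y'), mem_coe.2 (mem_filter.2 ⟨hmem M hM _ _ h, h⟩), rfl⟩
  · rintro ⟨x, y⟩ -
    rw [← pow_add]
    refine neg_one_pow_congr ?_
    have := hs x y
    simp only [Prod.map_apply, Nat.even_add, Int.even_add, Int.natAbs_even] at this ⊢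
    tauto

end Theta

section GeneratingFunction

open Nat.Partition PowerSeries.WithPiTopology

lemma regularPartitionCount_eq_card_countRestricted {t : ℕ} (ht : 0 < t) (n : ℕ) :
    regularPartitionCount t n = #(countRestricted n t) := by
  rw [← card_restricted_eq_card_countRestricted n ht, regularPartitionCount, restricted,
    Nat.card_eq_fintype_card, Fintype.card_subtype]

lemma mk_B_eq_mul (R : Type*) [CommRing R] {u v : ℕ} (hu : 0 < u) (hv : 0 < v) :
    PowerSeries.mk (fun n ↦ (B u v n : R)) =
      PowerSeries.mk (fun n ↦ (#(countRestricted n u) : R)) *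
        PowerSeries.mk (fun n ↦ (#(countRestricted n v) : R)) := by
  ext n
  rw [coeff_mul, Finset.Nat.sum_antidiagonal_eq_sum_range_succ_mk, coeff_mk, B]
  simp [regularPartitionCount_eq_card_countRestricted, hu, hv]

/-- The generating function of `B 3 2` modulo `3`. -/
lemma X_pow_dvd_mk_B_sub_eulerProd (n : ℕ) : (X : (ZMod 3)⟦X⟧) ^ (n + 1) ∣
    PowerSeries.mk (fun k ↦ (B 3 2 k : ZMod 3)) - qFactorial X n * qFactorial (X ^ 2) n := by
  let _ : TopologicalSpace (ZMod 3) := ⊥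
  have _ : DiscreteTopology (ZMod 3) := ⟨rfl⟩
  have h3 : (3 : (ZMod 3)⟦X⟧) = 0 := by
    have : (3 : ZMod 3) = 0 := rfl
    rw [← map_ofNat C 3, this, map_zero]
  have hprod := (hasProd_powerSeriesMk_card_countRestricted (ZMod 3) three_pos).mul
    (hasProd_powerSeriesMk_card_countRestricted (ZMod 3) two_pos)
  rw [← mk_B_eq_mul _ three_pos two_pos] at hprod
  have hterm : ∀ i : ℕ, (∑ j ∈ range 3, (X : (ZMod 3)⟦X⟧) ^ ((i + 1) * j)) *
      (∑ j ∈ range 2, X ^ ((i + 1) * j)) =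
      (1 - X ^ (i + 1)) * (1 - (X ^ 2) ^ (i + 1)) := by
    intro i
    simp only [sum_range_succ, range_zero, sum_empty, pow_mul]
    rw [pow_right_comm X 2 (i + 1)]
    linear_combination ((X : (ZMod 3)⟦X⟧) ^ (i + 1) + (X ^ (i + 1)) ^ 2) * h3
  simp_rw [hterm] at hprod
  have htend := hprod.tendsto_prod_nat
  simp_rw [prod_mul_distrib] at htend
  rw [X_pow_dvd_iff]
  intro d hd
  have hd' := (tendsto_iff_coeff_tendsto _ _ _ _).1 htend d
  rw [nhds_discrete, Filter.tendsto_pure, Filter.eventually_atTop] at hd'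
  obtain ⟨M, hM⟩ := hd'
  have hM' := hM (max M n) (le_max_left _ _)
  obtain ⟨A, _, φ, hX, hφ⟩ := exists_ringHom_X_pow (ZMod 3) (n + 1)
  have h1 := qFactorial_pow_eq hX one_ne_zero (le_max_right M n)
  have h2 := qFactorial_pow_eq hX two_ne_zero (le_max_right M n)
  rw [pow_one] at h1
  have hdvd : (X : (ZMod 3)⟦X⟧) ^ (n + 1) ∣ qFactorial X (max M n) * qFactorial (X ^ 2) (max M n) -
      qFactorial X n * qFactorial (X ^ 2) n := by
    rw [← hφ]
    simp [h1, h2]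
  rw [map_sub, ← hM']
  simpa [qFactorial] using X_pow_dvd_iff.1 hdvd d hd

lemma cast_B_eq_coeff_theta_one_three {N n : ℕ} (h : N ≤ n) :
    (B 3 2 N : ZMod 3) = coeff N (thetaTrunc (ZMod 3) 1 3 n * thetaTrunc (ZMod 3) 2 2 n) := by
  have := X_pow_dvd_iff.1 (dvd_add (X_pow_dvd_mk_B_sub_eulerProd n)
    (X_pow_dvd_eulerProd_sub_theta_one_three n)) N (Nat.lt_succ_of_le h)
  rwa [sub_add_sub_cancel, map_sub, sub_eq_zero, coeff_mk] at this

lemma cast_B_eq_coeff_theta_one_two {N n : ℕ} (h : N ≤ n) :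
    (B 3 2 N : ZMod 3) = coeff N (thetaTrunc (ZMod 3) 1 2 n * thetaTrunc (ZMod 3) 2 4 n) := by
  have := X_pow_dvd_iff.1 (dvd_add (X_pow_dvd_mk_B_sub_eulerProd n)
    (X_pow_dvd_eulerProd_sub_theta_one_two n)) N (Nat.lt_succ_of_le h)
  rwa [sub_add_sub_cancel, map_sub, sub_eq_zero, coeff_mk] at this

end GeneratingFunction

section Descent

/-- If `-d` is not a square modulo `p`, the form `a ^ 2 + d * b ^ 2` is anisotropic at `p`. -/
lemma dvd_and_dvd_of_dvd_sq_add_mul_sq {p : ℕ} [Fact p.Prime] {d : ℤ}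
    (hd : ¬ IsSquare (-d : ZMod p)) {a b : ℤ} (h : (p : ℤ) ∣ a ^ 2 + d * b ^ 2) :
    (p : ℤ) ∣ a ∧ (p : ℤ) ∣ b := by
  simp only [← ZMod.intCast_zmod_eq_zero_iff_dvd] at h ⊢
  push_cast at h
  have hb : (b : ZMod p) = 0 := by
    by_contra hb
    refine hd ⟨a / b, ?_⟩
    field_simp
    linear_combination -h
  rw [hb] at h
  exact ⟨by simpa using h, hb⟩

lemma injective_mul_add {u : ℤ} (hu : u ≠ 0) (h : ℤ) :
    Function.Injective fun x : ℤ ↦ u * x + h := by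
  intro x y hxy
  exact mul_left_cancel₀ hu (add_right_cancel hxy)

/-- The case of primes `p ≡ 3 (mod 4)`, through the representations of `8 * N + 1` by
`x ^ 2 + y ^ 2`. -/
lemma cast_B_of_mod_four_eq_three {p : ℕ} [Fact p.Prime] (hp : p % 4 = 3) {N M : ℕ}
    (hNM : 8 * N + 1 = p ^ 2 * (8 * M + 1)) {h : ℤ} (hh : 4 * h = p + 1) :
    (B 3 2 N : ZMod 3) = (-1) ^ h.natAbs * (B 3 2 M : ZMod 3) := by
  have hp0 : (p : ℤ) ≠ 0 := by omega
  have hMN : M ≤ N := by nlinarith [Nat.one_le_pow 2 p (by omega)]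
  have key : ∀ (x y : ℤ) (K : ℕ), thetaExp 1 3 x + thetaExp 2 2 y = K ↔
      (4 * x - 1) ^ 2 + 1 * (4 * y) ^ 2 = 8 * (K : ℤ) + 1 := by
    intro x y K
    have h1 := two_mul_thetaExp 1 3 x
    have h2 := two_mul_thetaExp 2 2 y
    push_cast at h1 h2
    zify
    constructor <;> intro <;> linarith
  have hd : ¬ IsSquare (-(1 : ℤ) : ZMod p) := by
    rintro ⟨a, ha⟩
    refine ZMod.mod_four_ne_three_of_sq_eq_neg_one (y := a) ?_ hp
    simpa [sq] using ha.symm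
  zify at hNM
  rw [cast_B_eq_coeff_theta_one_three le_rfl, cast_B_eq_coeff_theta_one_three hMN]
  refine coeff_thetaTrunc_mul_eq (by norm_num) (by norm_num) (by norm_num) (by norm_num) le_rfl hMN
    (injective_mul_add (neg_ne_zero.2 hp0) h) (injective_mul_add hp0 0) h ?_ ?_ ?_
  · intro x y
    have : ¬ Even (p : ℤ) := by
      rw [Int.even_coe_nat, Nat.even_iff]
      omega
    simp only [Int.even_add, Int.even_mul, even_neg, this, Even.zero]
    tauto
  · intro x y hxy
    rw [key] at hxy ⊢
    rw [hNM, ← hxy]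
    linear_combination (4 * h + 2 * (-p * (4 * x) - 1) + p + 1) * hh
  · intro x y hxy
    rw [key, hNM] at hxy
    obtain ⟨⟨w, hw⟩, ⟨v, hv⟩⟩ := dvd_and_dvd_of_dvd_sq_add_mul_sq hd
      (hxy ▸ Dvd.dvd.mul_right (dvd_pow_self _ two_ne_zero) _)
    obtain ⟨y', rfl⟩ : (4 : ℤ) ∣ v := by
      have : IsCoprime (4 : ℤ) p := ⟨h, -1, by linear_combination hh⟩
      exact this.dvd_of_dvd_mul_left ⟨y, hv.symm⟩
    refine ⟨x - h * w, y', ?_, by linarith, ?_⟩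
    · linear_combination x * hh - h * hw
    · rw [key]
      refine mul_left_cancel₀ (pow_ne_zero 2 hp0) ?_
      rw [← hxy, hw, hv, show 4 * (x - h * w) - 1 = -w by linear_combination hw - w * hh]
      ring

/-- The case of odd primes `p ≠ 3` modulo which `-2` is not a square, through the
representations of `24 * N + 3` by `x ^ 2 + 2 * y ^ 2`. -/
lemma cast_B_of_not_isSquare_neg_two {p : ℕ} [Fact p.Prime] (hp : ¬ IsSquare (-(2 : ℤ) : ZMod p))
    (hodd : ¬ Even (p : ℤ)) {N M : ℕ} (hNM : 8 * N + 1 = p ^ 2 * (8 * M + 1)) {u h : ℤ}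
    (hu : u ^ 2 = p ^ 2) (hh : 6 * h = 1 - u) :
    (B 3 2 N : ZMod 3) = (B 3 2 M : ZMod 3) := by
  have hp0 : (p : ℤ) ≠ 0 := by
    rintro h
    simp [h] at hodd
  have hu0 : u ≠ 0 := by
    rintro rfl
    exact pow_ne_zero 2 hp0 (by rw [← hu]; rfl)
  have hMN : M ≤ N := by
    have : 1 ≤ p ^ 2 := Nat.one_le_pow 2 p (by omega)
    nlinarith
  have hpu : u ∣ p := (Int.pow_dvd_pow_iff two_ne_zero).1 hu.dvd
  have hup : (p : ℤ) ∣ u := (Int.pow_dvd_pow_iff two_ne_zero).1 hu.symm.dvd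
  have key : ∀ (x y : ℤ) (K : ℕ), thetaExp 1 2 x + thetaExp 2 4 y = K ↔
      (6 * x - 1) ^ 2 + 2 * (6 * y - 1) ^ 2 = 3 * (8 * (K : ℤ) + 1) := by
    intro x y K
    have h1 := two_mul_thetaExp 1 2 x
    have h2 := two_mul_thetaExp 2 4 y
    push_cast at h1 h2
    zify
    constructor <;> intro <;> linarith
  zify at hNM
  rw [← hu] at hNM
  rw [cast_B_eq_coeff_theta_one_two le_rfl, cast_B_eq_coeff_theta_one_two hMN]
  rw [coeff_thetaTrunc_mul_eq (by norm_num) (by norm_num) (by norm_num) (by norm_num) le_rfl hMN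
    (injective_mul_add hu0 h) (injective_mul_add hu0 h) 0 ?_ ?_ ?_]
  · simp
  · intro x y
    have : ¬ Even u := by
      rw [← Int.even_pow' two_ne_zero, hu, Int.even_pow' two_ne_zero]
      exact hodd
    simp only [Int.even_add, Int.even_mul, this, Even.zero]
    tauto
  · intro x y hxy
    rw [key] at hxy ⊢
    have e : ∀ z : ℤ, 6 * (u * z + h) - 1 = u * (6 * z - 1) := fun z ↦ by linear_combination hh
    rw [e, e, hNM]
    linear_combination u ^ 2 * hxy
  · intro x y hxy
    rw [key, hNM] at hxy
    have hdvd : (p : ℤ) ∣ 3 * (u ^ 2 * (8 * M + 1)) :=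
      Dvd.dvd.mul_left (Dvd.dvd.mul_right (hup.trans (dvd_pow_self _ two_ne_zero)) _) _
    obtain ⟨hx, hy⟩ := dvd_and_dvd_of_dvd_sq_add_mul_sq hp (hxy ▸ hdvd)
    obtain ⟨w, hw⟩ := hpu.trans hx
    obtain ⟨v, hv⟩ := hpu.trans hy
    refine ⟨x + h * w, y + h * v, ?_, ?_, ?_⟩
    · linear_combination x * hh - h * hw
    · linear_combination y * hh - h * hv
    · rw [key]
      refine mul_left_cancel₀ (pow_ne_zero 2 hu0) ?_
      rw [show 6 * (x + h * w) - 1 = w by linear_combination hw + w * hh,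
        show 6 * (y + h * v) - 1 = v by linear_combination hv + v * hh]
      rw [hw, hv] at hxy
      linear_combination hxy

end Descent

/-- Theorem 1.5(iii): a multiplicative formula for `B 3 2` modulo 3. -/
theorem B_3_2_mult (t : ℕ) (ht : t = 3 ∨ t = 5 ∨ t = 7) (k n : ℕ) (hk : 0 < k) (hn : 0 < n)
    (p : ℕ) (hp : p.Prime) (hpt : p % 8 = t) (r : ℕ) (hr : p ∣ 8 * r + t) :
    (B 3 2 (p ^ (k + 1) * n + p * r + (t * p - 1) / 8) : ℤ)
      ≡ -(@legendreSym p ⟨hp⟩ (-2))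
          * (B 3 2 (p ^ (k - 1) * n + (8 * r + t - p) / (8 * p)) : ℤ) [ZMOD 3] := by
  have : Fact p.Prime := ⟨hp⟩
  have hp0 : 0 < p := hp.pos
  obtain ⟨c, hc⟩ : ∃ c, t * p = 8 * c + 1 := by
    refine ⟨t * p / 8, ?_⟩
    have : t * p % 8 = 1 := by
      rw [Nat.mul_mod, hpt]
      rcases ht with rfl | rfl | rfl <;> rfl
    omega
  obtain ⟨e, he⟩ : ∃ e, 8 * r + t = p * (8 * e + 1) := by
    obtain ⟨m, hm⟩ := hr
    refine ⟨m / 8, ?_⟩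
    have h1 : p * m % 8 = t := by
      rw [← hm]
      omega
    rw [Nat.mul_mod, hpt] at h1
    have h2 : m % 8 = 1 := by
      have := Nat.mod_lt m (show 0 < 8 by norm_num)
      rcases ht with rfl | rfl | rfl <;> interval_cases m % 8 <;> omega
    rw [hm]
    congr 1
    omega
  have hN : (t * p - 1) / 8 = c := by omega
  have hM : (8 * r + t - p) / (8 * p) = e := by
    rw [he]
    refine Nat.div_eq_of_eq_mul_left (by positivity) ?_
    rw [mul_add, mul_one, Nat.add_sub_cancel]
    ring
  rw [hN, hM]
  obtain ⟨k, rfl⟩ := Nat.exists_eq_add_one_of_ne_zero hk.ne'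
  rw [Nat.add_sub_cancel]
  have hNM : 8 * (p ^ (k + 1 + 1) * n + p * r + c) + 1 = p ^ 2 * (8 * (p ^ k * n + e) + 1) := by
    linear_combination p * he - hc
  refine (ZMod.intCast_eq_intCast_iff _ _ 3).1 ?_
  push_cast
  have hp2 : p ≠ 2 := by
    rintro rfl
    omega
  have hsq := ZMod.exists_sq_eq_neg_two_iff hp2
  have h20 : ((-2 : ℤ) : ZMod p) ≠ 0 := by
    rw [Ne, ZMod.intCast_zmod_eq_zero_iff_dvd, dvd_neg]
    intro h
    exact hp2 ((Nat.prime_dvd_prime_iff_eq hp Nat.prime_two).1 (by exact_mod_cast h))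
  have hodd : ¬ Even (p : ℤ) := by
    rw [Int.even_coe_nat, Nat.even_iff]
    omega
  rcases ht with rfl | rfl | rfl
  · have hL : legendreSym p (-2) = 1 := by
      rw [legendreSym.eq_one_iff p h20]
      push_cast
      exact hsq.2 (Or.inr hpt)
    obtain ⟨h, hh⟩ : ∃ h : ℤ, 4 * h = p + 1 := ⟨(p + 1) / 4, by omega⟩
    rw [cast_B_of_mod_four_eq_three (by omega) hNM hh, hL,
      Odd.neg_one_pow (Int.natAbs_odd.2 (by grind))]
    simp
  all_goals
    have hns : ¬ IsSquare (-2 : ZMod p) := by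
      rw [hsq]
      omega
    have hL : legendreSym p (-2) = -1 := by
      rw [legendreSym.eq_neg_one_iff]
      push_cast
      exact hns
  · have h3 : p % 3 ≠ 0 := by
      intro h
      have := (Nat.prime_dvd_prime_iff_eq Nat.prime_three hp).1 (Nat.dvd_of_mod_eq_zero h)
      omega
    obtain ⟨u, h, hu, hh⟩ : ∃ u h : ℤ, u ^ 2 = p ^ 2 ∧ 6 * h = 1 - u := by
      rcases (show p % 3 = 1 ∨ p % 3 = 2 by omega) with h | h
      · exact ⟨p, (1 - p) / 6, rfl, by omega⟩
      · exact ⟨-p, (1 + p) / 6, by ring, by omega⟩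
    rw [cast_B_of_not_isSquare_neg_two (by exact_mod_cast hns) hodd hNM hu hh, hL]
    simp
  · obtain ⟨h, hh⟩ : ∃ h : ℤ, 4 * h = p + 1 := ⟨(p + 1) / 4, by omega⟩
    rw [cast_B_of_mod_four_eq_three (by omega) hNM hh, hL,
      Even.neg_one_pow (Int.natAbs_even.2 (by grind))]
    simp
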